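/- arXiv:2112.11100 — 8 statements merged into one kernel-verified Lean document; each statement's English description precedes it below -/
import Mathlib

section
/- Let q, q' ∈ ℂ³ be nonzero row vectors that are not proportional to each other, and let m, m' ∈ ℂ³ be nonzero column vectors that are not proportional to each other, with qm ≠ 0 and q'm' ≠ 0. Then the intersection L_{q,m} ∩ L_{q',m'} is nonempty if and only if (m×m')(q×q') = 0; and in that case every (p,ℓ) ∈ L_{q,m} ∩ L_{q',m'} has p a nonzero scalar multiple of the row vector m×m' and ℓ a nonzero scalar multiple of the column vector q×q', so that the intersection is the single projective point represented by (m×m', q×q'). -/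
open Matrix Complex

noncomputable section

/-- Elements of `ℂ³`. -/
abbrev V3 : Type := Fin 3 → ℂ

/-- The natural pairing `pℓ = p₀ℓ₀ + p₁ℓ₁ + p₂ℓ₂` of a row vector and a column vector. -/
def pairing (p ℓ : V3) : ℂ := p 0 * ℓ 0 + p 1 * ℓ 1 + p 2 * ℓ 2

/-- The cross product of two vectors of `ℂ³`. -/
def cross (u v : V3) : V3 :=
  ![u 1 * v 2 - u 2 * v 1, u 2 * v 0 - u 0 * v 2, u 0 * v 1 - u 1 * v 0]

/-- `(p,ℓ)` belongs to the bidegree `(1,1)` curve `L_{q,m}` in the flag manifold. -/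
def inL (q m p ℓ : V3) : Prop :=
  p ≠ 0 ∧ ℓ ≠ 0 ∧ pairing p ℓ = 0 ∧ pairing q ℓ = 0 ∧ pairing p m = 0

theorem exists_smul_of_cross_eq_zero (a b : V3) (ha : a ≠ 0) (h : cross a b = 0) :
    ∃ c : ℂ, b = c • a := by
  have h0 := congrFun h 0
  have h1 := congrFun h 1
  have h2 := congrFun h 2
  simp [cross] at h0 h1 h2
  obtain ⟨i, hi⟩ : ∃ i, a i ≠ 0 := by
    by_contra hc
    push Not at hc
    exact ha (funext hc)
  refine ⟨b i / a i, ?_⟩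
  ext j
  simp only [Pi.smul_apply, smul_eq_mul]
  rw [div_mul_eq_mul_div, eq_div_iff hi]
  fin_cases i <;> fin_cases j <;> simp <;> grind

theorem eq_smul_cross (u v x : V3) (hw : cross u v ≠ 0) (hx : x ≠ 0)
    (hu : pairing x u = 0) (hv : pairing x v = 0) :
    ∃ c : ℂ, c ≠ 0 ∧ x = c • cross u v := by
  obtain ⟨c, hc⟩ := exists_smul_of_cross_eq_zero (cross u v) x hw (by
    simp only [pairing] at hu hv
    ext j
    fin_cases j <;> simp [cross]
    · linear_combination v 0 * hu - u 0 * hv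
    · linear_combination v 1 * hu - u 1 * hv
    · linear_combination v 2 * hu - u 2 * hv)
  refine ⟨c, ?_, hc⟩
  rintro rfl
  exact hx (by simpa using hc)

theorem pairing_symm (u v : V3) : pairing u v = pairing v u := by
  simp only [pairing]; ring

theorem stmt_0 (q q' m m' : V3) (hq : q ≠ 0) (hq' : q' ≠ 0) (hm : m ≠ 0) (hm' : m' ≠ 0)
    (hqq' : ∀ c : ℂ, q' ≠ c • q) (hmm' : ∀ c : ℂ, m' ≠ c • m)
    (hqm : pairing q m ≠ 0) (hq'm' : pairing q' m' ≠ 0) :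
    ((∃ p ℓ : V3, inL q m p ℓ ∧ inL q' m' p ℓ) ↔
      pairing (cross m m') (cross q q') = 0) ∧
    (∀ p ℓ : V3, inL q m p ℓ → inL q' m' p ℓ →
      (∃ c : ℂ, c ≠ 0 ∧ p = c • cross m m') ∧ (∃ d : ℂ, d ≠ 0 ∧ ℓ = d • cross q q')) := by
  have hM : cross m m' ≠ 0 := fun h =>
    let ⟨c, hc⟩ := exists_smul_of_cross_eq_zero m m' hm h
    hmm' c hc
  have hQ : cross q q' ≠ 0 := fun h =>
    let ⟨c, hc⟩ := exists_smul_of_cross_eq_zero q q' hq h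
    hqq' c hc
  have key : ∀ p ℓ : V3, inL q m p ℓ → inL q' m' p ℓ →
      (∃ c : ℂ, c ≠ 0 ∧ p = c • cross m m') ∧ (∃ d : ℂ, d ≠ 0 ∧ ℓ = d • cross q q') := by
    rintro p ℓ ⟨hp, hl, -, h1, h2⟩ ⟨-, -, -, h3, h4⟩
    exact ⟨eq_smul_cross m m' p hM hp h2 h4,
      eq_smul_cross q q' ℓ hQ hl (by rw [pairing_symm, h1]) (by rw [pairing_symm, h3])⟩
  refine ⟨⟨?_, ?_⟩, key⟩
  · rintro ⟨p, ℓ, h, h'⟩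
    obtain ⟨⟨c, hc, rfl⟩, ⟨d, hd, rfl⟩⟩ := key p ℓ h h'
    have h0 := h.2.2.1
    have : c * d * pairing (cross m m') (cross q q') = 0 := by
      rw [← h0]
      simp only [pairing, Pi.smul_apply, smul_eq_mul]
      ring
    simpa [hc, hd] using this
  · intro h
    refine ⟨cross m m', cross q q', ⟨hM, hQ, h, ?_, ?_⟩, ⟨hM, hQ, h, ?_, ?_⟩⟩ <;>
    · simp [pairing, cross]
      ring
end
end

section
/- Let q, q' ∈ ℂ³ be nonzero row vectors and m, m' ∈ ℂ³ nonzero column vectors with qm ≠ 0 and q'm' ≠ 0, and suppose the pairs ([q],[m]) and ([q'],[m']) are distinct as points of ℙ²×ℙ²∨ (i.e. q is not proportional to q', or m is not proportional to m'). Then L_{q,m} intersects L_{q',m'} if and only if (m×m')(q×q') = 0. -/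
open Matrix Complex

noncomputable section

theorem cross_zero_prop (u v : V3) (hu : u ≠ 0) (h : cross u v = 0) : ∃ c : ℂ, v = c • u := by
  have h0 := congrFun h 0
  have h1 := congrFun h 1
  have h2 := congrFun h 2
  simp only [cross, Matrix.cons_val, Pi.zero_apply] at h0 h1 h2
  obtain ⟨i, hi⟩ := Function.ne_iff.mp hu
  simp only [Pi.zero_apply] at hi
  refine ⟨v i / u i, ?_⟩
  ext j
  simp only [Pi.smul_apply, smul_eq_mul]
  rw [div_mul_eq_mul_div, eq_div_iff hi]
  fin_cases i <;> fin_cases j <;> simp only [Fin.zero_eta, Fin.mk_one, Fin.reduceFinMk] <;> grind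

theorem ann_prop (p m m' : V3) (h1 : pairing p m = 0) (h2 : pairing p m' = 0)
    (h : cross m m' ≠ 0) : ∃ c : ℂ, p = c • cross m m' := by
  apply cross_zero_prop _ _ h
  simp only [pairing] at h1 h2
  ext j
  fin_cases j <;> simp [cross] <;> grind

theorem pairing_comm' (a b : V3) : pairing a b = pairing b a := by
  simp only [pairing]; ring

theorem pairing_smul' (c : ℂ) (a b : V3) : pairing a (c • b) = c * pairing a b := by
  simp only [pairing, Pi.smul_apply, smul_eq_mul]; ring

theorem pairing_cross_left (a b : V3) : pairing (cross a b) a = 0 := by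
  simp [pairing, cross]; ring

theorem pairing_cross_right (a b : V3) : pairing (cross a b) b = 0 := by
  simp [pairing, cross]; ring

/-- If `y` is orthogonal to `q` and `qm ≠ 0`, then `m × y ≠ 0`. -/
theorem cross_ne (q m y : V3) (hm : m ≠ 0) (hqm : pairing q m ≠ 0) (hy : y ≠ 0)
    (hqy : pairing q y = 0) : cross m y ≠ 0 := by
  intro h
  obtain ⟨c, rfl⟩ := cross_zero_prop _ _ hm h
  rw [pairing_smul'] at hqy
  rcases mul_eq_zero.mp hqy with h | h
  · exact hy (by simp [h])
  · exact hqm h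

theorem stmt_1 (q q' m m' : V3) (hq : q ≠ 0) (hq' : q' ≠ 0) (hm : m ≠ 0) (hm' : m' ≠ 0)
    (hdist : (∀ c : ℂ, q' ≠ c • q) ∨ (∀ c : ℂ, m' ≠ c • m))
    (hqm : pairing q m ≠ 0) (hq'm' : pairing q' m' ≠ 0) :
    (∃ p ℓ : V3, inL q m p ℓ ∧ inL q' m' p ℓ) ↔
      pairing (cross m m') (cross q q') = 0 := by
  constructor
  · rintro ⟨p, ℓ, ⟨hp, hl, hpl, hql, hpm⟩, -, -, -, hql', hpm'⟩
    by_cases hX : cross m m' = 0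
    · simp [hX, pairing]
    by_cases hY : cross q q' = 0
    · simp [hY, pairing]
    obtain ⟨c, rfl⟩ := ann_prop p m m' hpm hpm' hX
    obtain ⟨d, rfl⟩ := ann_prop ℓ q q' (by rwa [pairing_comm']) (by rwa [pairing_comm']) hY
    rw [pairing_smul', pairing_comm', pairing_smul', pairing_comm'] at hpl
    have hc : c ≠ 0 := fun h => hp (by simp [h])
    have hd : d ≠ 0 := fun h => hl (by simp [h])
    simpa [hc, hd] using hpl
  · intro h
    have hqY : pairing q (cross q q') = 0 := by rw [pairing_comm']; exact pairing_cross_left _ _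
    have hqY' : pairing q' (cross q q') = 0 := by rw [pairing_comm']; exact pairing_cross_right _ _
    have hXm := pairing_cross_left m m'
    have hXm' := pairing_cross_right m m'
    by_cases hX : cross m m' = 0
    · obtain ⟨c, rfl⟩ := cross_zero_prop _ _ hm hX
      have hY : cross q q' ≠ 0 := by
        intro hY
        obtain ⟨d, rfl⟩ := cross_zero_prop _ _ hq hY
        rcases hdist with h | h
        · exact h d rfl
        · exact h c rfl
      have hp := cross_ne q m _ hm hqm hY hqY
      have e1 := pairing_cross_left m (cross q q')
      have e2 := pairing_cross_right m (cross q q')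
      exact ⟨_, _, ⟨hp, hY, e2, hqY, e1⟩, hp, hY, e2, hqY', by rw [pairing_smul', e1, mul_zero]⟩
    by_cases hY : cross q q' = 0
    · obtain ⟨c, rfl⟩ := cross_zero_prop _ _ hq hY
      have hl := cross_ne m q _ hq (by rwa [pairing_comm']) hX (by rwa [pairing_comm'])
      have e1 : pairing q (cross q (cross m m')) = 0 := by
        rw [pairing_comm']; exact pairing_cross_left _ _
      have e2 : pairing (cross m m') (cross q (cross m m')) = 0 := by
        rw [pairing_comm']; exact pairing_cross_right _ _
      exact ⟨_, _, ⟨hX, hl, e2, e1, hXm⟩, hX, hl, e2,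
        by rw [pairing_comm', pairing_smul', pairing_comm', e1, mul_zero], hXm'⟩
    exact ⟨_, _, ⟨hX, hY, h, hqY, hXm⟩, hX, hY, h, hqY', hXm'⟩
end
end

section
/- Let A be a 3×3 complex matrix that is not a scalar multiple of the identity. Then there exist s, t ∈ ℂ with s ≠ 0 and an invertible matrix C ∈ GL₃(ℂ) such that C⁻¹(sA + tI)C is one of the following matrices: A₁(λ) = [[0,0,0],[0,1,0],[0,0,λ]] for some λ ∈ ℂ∖{0,1}; A₂ = [[0,0,0],[0,0,0],[0,0,1]]; A₃ = [[0,1,0],[0,0,0],[0,0,1]]; A₄ = [[0,1,0],[0,0,0],[0,0,0]]; or A₅ = [[0,1,0],[0,0,1],[0,0,0]]. -/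
open Matrix Complex

noncomputable section

/-- `B` is conjugate to `sA+tI` for some `s ≠ 0`. -/
def ARel (A B : Matrix (Fin 3) (Fin 3) ℂ) : Prop :=
  ∃ (s t : ℂ) (C : Matrix (Fin 3) (Fin 3) ℂ), s ≠ 0 ∧ C.det ≠ 0 ∧ (s • A + t • 1) * C = C * B

theorem ARel.trans {A B D : Matrix (Fin 3) (Fin 3) ℂ} (h : ARel A B) (h' : ARel B D) :
    ARel A D := by
  obtain ⟨s, t, C, hs, hC, e⟩ := h
  obtain ⟨s', t', C', hs', hC', e'⟩ := h'
  refine ⟨s' * s, s' * t + t', C * C', mul_ne_zero hs' hs, by simp [hC, hC'], ?_⟩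
  have : ((s' * s) • A + (s' * t + t') • (1 : Matrix (Fin 3) (Fin 3) ℂ))
      = s' • (s • A + t • 1) + t' • 1 := by
    simp only [smul_add, smul_smul, add_smul, add_assoc]
  rw [this, ← Matrix.mul_assoc, add_mul, smul_mul_assoc, e, Matrix.mul_assoc, ← e']
  simp [mul_add, add_mul, Matrix.mul_assoc]

theorem ARel.conj {A B : Matrix (Fin 3) (Fin 3) ℂ} (h : ARel A B) :
    ∃ (s t : ℂ) (C : Matrix (Fin 3) (Fin 3) ℂ), s ≠ 0 ∧ IsUnit C ∧
      C⁻¹ * (s • A + t • 1) * C = B := by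
  obtain ⟨s, t, C, hs, hC, e⟩ := h
  have hu : IsUnit C.det := isUnit_iff_ne_zero.2 hC
  refine ⟨s, t, C, hs, (Matrix.isUnit_iff_isUnit_det C).2 hu, ?_⟩
  rw [Matrix.mul_assoc, e, ← Matrix.mul_assoc, Matrix.nonsing_inv_mul C hu, Matrix.one_mul]

theorem ARel.scalar {A : Matrix (Fin 3) (Fin 3) ℂ} {c : ℂ} (h : ARel A (c • 1)) :
    ∃ d : ℂ, A = d • 1 := by
  obtain ⟨s, t, C, hs, hC, e⟩ := h
  have hu : IsUnit C.det := isUnit_iff_ne_zero.2 hC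
  have h1 : s • A + t • 1 = c • (1 : Matrix (Fin 3) (Fin 3) ℂ) := by
    have := congrArg (· * C⁻¹) e
    simpa [Matrix.mul_assoc, Matrix.mul_nonsing_inv C hu] using this
  refine ⟨s⁻¹ * (c - t), ?_⟩
  rw [mul_smul, sub_smul, ← h1]
  simp [smul_smul, hs]

theorem exists_basis_col (v : Fin 3 → ℂ) (hv : v ≠ 0) :
    ∃ C : Matrix (Fin 3) (Fin 3) ℂ, C.det ≠ 0 ∧ C *ᵥ ![1, 0, 0] = v := by
  by_cases h0 : v 0 = 0
  · by_cases h1 : v 1 = 0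
    · have h2 : v 2 ≠ 0 := by
        intro h2; apply hv; ext i; fin_cases i <;> simp [h0, h1, h2]
      refine ⟨!![v 0, 1, 0; v 1, 0, 1; v 2, 0, 0], by simp [det_fin_three, h2], ?_⟩
      ext i; fin_cases i <;> simp [mulVec, dotProduct, Fin.sum_univ_three]
    · refine ⟨!![v 0, 1, 0; v 1, 0, 0; v 2, 0, 1], by simp [det_fin_three, h1], ?_⟩
      ext i; fin_cases i <;> simp [mulVec, dotProduct, Fin.sum_univ_three]
  · refine ⟨!![v 0, 0, 0; v 1, 1, 0; v 2, 0, 1], by simp [det_fin_three, h0], ?_⟩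
    ext i; fin_cases i <;> simp [mulVec, dotProduct, Fin.sum_univ_three]

theorem exists_block (A : Matrix (Fin 3) (Fin 3) ℂ) :
    ∃ a x y b c d e : ℂ, ARel A !![a, x, y; 0, b, c; 0, d, e] := by
  obtain ⟨a, ha⟩ := Module.End.exists_eigenvalue (Matrix.toLin' A)
  obtain ⟨v, hv⟩ := ha.exists_hasEigenvector
  have hav : A *ᵥ v = a • v := by simpa using hv.apply_eq_smul
  obtain ⟨C, hC, hCv⟩ := exists_basis_col v hv.2
  have hu : IsUnit C.det := isUnit_iff_ne_zero.2 hC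
  obtain ⟨B, hB⟩ : ∃ B, B = C⁻¹ * A * C := ⟨_, rfl⟩
  have h1 : B *ᵥ ![1, 0, 0] = a • ![1, 0, 0] := by
    rw [hB, ← mulVec_mulVec, hCv, ← mulVec_mulVec, hav, mulVec_smul, ← hCv, mulVec_mulVec,
      Matrix.nonsing_inv_mul C hu, one_mulVec]
  have e1 := congrFun h1 1
  have e2 := congrFun h1 2
  simp [mulVec, dotProduct, Fin.sum_univ_three] at e1 e2
  refine ⟨B 0 0, B 0 1, B 0 2, B 1 1, B 1 2, B 2 1, B 2 2, 1, 0, C, one_ne_zero, hC, ?_⟩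
  have h3 : !![B 0 0, B 0 1, B 0 2; 0, B 1 1, B 1 2; 0, B 2 1, B 2 2] = B := by
    ext i j; fin_cases i <;> fin_cases j <;> simp [e1, e2]
  rw [h3, hB]
  simp [← Matrix.mul_assoc, Matrix.mul_nonsing_inv C hu]

theorem exists_tri (A : Matrix (Fin 3) (Fin 3) ℂ) :
    ∃ a x y b z c : ℂ, ARel A !![a, x, y; 0, b, z; 0, 0, c] := by
  obtain ⟨a, x, y, b, c, d, e, h⟩ := exists_block A
  by_cases hd : d = 0
  · subst hd; exact ⟨_, _, _, _, _, _, h⟩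
  · obtain ⟨w, hw⟩ := IsAlgClosed.exists_pow_nat_eq ((b - e) ^ 2 + 4 * c * d) (n := 2) (by norm_num)
    obtain ⟨r, hr⟩ : ∃ r, r = (b + e + w) / 2 := ⟨_, rfl⟩
    have hr2 : r ^ 2 - (b + e) * r + (b * e - c * d) = 0 := by
      rw [hr]; linear_combination (1 / 4) * hw
    refine ⟨a, x * (r - e) + y * d, x, r, 1, b + e - r, h.trans
      ⟨1, 0, !![1, 0, 0; 0, r - e, 1; 0, d, 0], one_ne_zero, by simp [det_fin_three, hd], ?_⟩⟩
    ext i j; fin_cases i <;> fin_cases j <;> simp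
    all_goals first | ring1 | linear_combination hr2 | linear_combination -hr2

/-- The list of normal forms. -/
def NF (B : Matrix (Fin 3) (Fin 3) ℂ) : Prop :=
  (∃ lam : ℂ, lam ≠ 0 ∧ lam ≠ 1 ∧ B = !![0,0,0; 0,1,0; 0,0,lam]) ∨
  B = !![0,0,0; 0,0,0; 0,0,1] ∨ B = !![0,1,0; 0,0,0; 0,0,1] ∨
  B = !![0,1,0; 0,0,0; 0,0,0] ∨ B = !![0,1,0; 0,0,1; 0,0,0]

theorem ARel.mk' {A B : Matrix (Fin 3) (Fin 3) ℂ} (k t : ℂ) (C : Matrix (Fin 3) (Fin 3) ℂ)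
    (hk : k ≠ 0) (hC : C.det ≠ 0) (h : A * C + t • C = k • (C * B)) : ARel A B := by
  refine ⟨k⁻¹, k⁻¹ * t, C, inv_ne_zero hk, hC, ?_⟩
  have : C * B = k⁻¹ • (k • (C * B)) := by simp [smul_smul, hk]
  rw [this, ← h]
  simp [add_mul, smul_smul]

set_option maxHeartbeats 2000000 in
theorem tri_NF (a x y b z c : ℂ) (hs : ¬ (b = a ∧ c = a ∧ x = 0 ∧ y = 0 ∧ z = 0)) :
    ∃ B, NF B ∧ ARel !![a, x, y; 0, b, z; 0, 0, c] B := by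
  by_cases hb : b = a
  · subst hb
    by_cases hc : c = b
    · subst hc
      by_cases hx : x = 0
      · subst hx
        by_cases hy : y = 0
        · have hz : z ≠ 0 := by rintro rfl; simp_all
          refine ⟨_, .inr (.inr (.inr (.inl rfl))), ARel.mk' 1 (-c) !![y, 0, 1; z, 0, 0; 0, 1, 0]
            one_ne_zero (by simp [det_fin_three, hz]) ?_⟩
          ext i j; fin_cases i <;> fin_cases j <;>
            simp <;> ring
        · refine ⟨_, .inr (.inr (.inr (.inl rfl))), ARel.mk' 1 (-c) !![y, 0, 0; z, 0, 1; 0, 1, 0]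
            one_ne_zero (by simp [det_fin_three, hy]) ?_⟩
          ext i j; fin_cases i <;> fin_cases j <;>
            simp <;> ring
      · by_cases hz : z = 0
        · subst hz
          refine ⟨_, .inr (.inr (.inr (.inl rfl))), ARel.mk' 1 (-c) !![x, 0, 0; 0, 1, -y; 0, 0, x]
            one_ne_zero (by simp [det_fin_three, hx]) ?_⟩
          ext i j; fin_cases i <;> fin_cases j <;>
            simp <;> ring
        · refine ⟨_, .inr (.inr (.inr (.inr rfl))),
            ARel.mk' 1 (-c) !![x * z, y, 0; 0, z, 0; 0, 0, 1]
            one_ne_zero (by simp [det_fin_three, hx, hz]) ?_⟩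
          ext i j; fin_cases i <;> fin_cases j <;>
            simp <;> ring
    · have hcb : c - b ≠ 0 := sub_ne_zero.2 hc
      by_cases hx : x = 0
      · subst hx
        refine ⟨_, .inr (.inl rfl), ARel.mk' (c - b) (-b) !![1, 0, y; 0, 1, z; 0, 0, c - b]
            hcb (by simp [det_fin_three, hcb]) ?_⟩
        ext i j; fin_cases i <;> fin_cases j <;>
            simp <;> ring
      · refine ⟨_, .inr (.inr (.inl rfl)), ARel.mk' (c - b) (-b)
            !![x, 0, x * z + y * (c - b); 0, c - b, z * (c - b); 0, 0, (c - b) ^ 2]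
            hcb (by simp [det_fin_three, hcb, hx]) ?_⟩
        ext i j; fin_cases i <;> fin_cases j <;>
            simp <;> ring
  · by_cases hc : c = b
    · subst hc
      have hk : a - c ≠ 0 := sub_ne_zero.2 (Ne.symm hb)
      by_cases hz : z = 0
      · subst hz
        refine ⟨_, .inr (.inl rfl), ARel.mk' (a - c) (-c) !![-x, -y, 1; a - c, 0, 0; 0, a - c, 0]
            hk (by simp [det_fin_three, hk]) ?_⟩
        ext i j; fin_cases i <;> fin_cases j <;>
            simp <;> ring
      · refine ⟨_, .inr (.inr (.inl rfl)), ARel.mk' (a - c) (-c)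
            !![-x * z, -y * (a - c) - x * z, 1; z * (a - c), 0, 0; 0, (a - c) ^ 2, 0]
            hk (by simp [det_fin_three, hk, hz]) ?_⟩
        ext i j; fin_cases i <;> fin_cases j <;>
            simp <;> ring
    · have hk : b - a ≠ 0 := sub_ne_zero.2 hb
      by_cases hca : c = a
      · subst hca
        by_cases h : y * (b - c) - x * z = 0
        · refine ⟨_, .inr (.inl rfl), ARel.mk' (b - c) (-c) !![1, 0, x; 0, -z, b - c; 0, b - c, 0]
            hk (by simp [det_fin_three, hk]) ?_⟩
          ext i j; fin_cases i <;> fin_cases j <;>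
            simp <;>
            first | ring1 | linear_combination h
        · refine ⟨_, .inr (.inr (.inl rfl)), ARel.mk' (b - c) (-c)
            !![y * (b - c) - x * z, 0, x; 0, -z * (b - c), b - c; 0, (b - c) ^ 2, 0]
            hk (by simp [det_fin_three, hk, h]) ?_⟩
          ext i j; fin_cases i <;> fin_cases j <;>
            simp <;> ring
      · have hca' : c - a ≠ 0 := sub_ne_zero.2 hca
        have hcb : c - b ≠ 0 := sub_ne_zero.2 hc
        refine ⟨_, .inl ⟨(c - a) / (b - a), div_ne_zero hca' hk, ?_, rfl⟩, ARel.mk' (b - a) (-a)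
            !![1, x, x * z + y * (c - b); 0, b - a, z * (c - a); 0, 0, (c - a) * (c - b)]
            hk (by simp [det_fin_three, hk, hca', hcb]) ?_⟩
        · intro h
          rw [div_eq_one_iff_eq hk] at h
          exact hc (by linear_combination h)
        · ext i j; fin_cases i <;> fin_cases j <;>
            simp <;> field_simp <;> ring

theorem stmt_2 (A : Matrix (Fin 3) (Fin 3) ℂ)
    (hA : ∀ c : ℂ, A ≠ c • (1 : Matrix (Fin 3) (Fin 3) ℂ)) :
    ∃ (s t : ℂ) (C : Matrix (Fin 3) (Fin 3) ℂ), s ≠ 0 ∧ IsUnit C ∧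
      ((∃ lam : ℂ, lam ≠ 0 ∧ lam ≠ 1 ∧
          C⁻¹ * (s • A + t • 1) * C = !![0,0,0; 0,1,0; 0,0,lam]) ∨
        C⁻¹ * (s • A + t • 1) * C = !![0,0,0; 0,0,0; 0,0,1] ∨
        C⁻¹ * (s • A + t • 1) * C = !![0,1,0; 0,0,0; 0,0,1] ∨
        C⁻¹ * (s • A + t • 1) * C = !![0,1,0; 0,0,0; 0,0,0] ∨
        C⁻¹ * (s • A + t • 1) * C = !![0,1,0; 0,0,1; 0,0,0]) := by
  obtain ⟨a, x, y, b, z, c, h⟩ := exists_tri A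
  obtain ⟨B, hB, h'⟩ := tri_NF a x y b z c (by
    rintro ⟨rfl, rfl, rfl, rfl, rfl⟩
    have e : !![c, 0, 0; 0, c, 0; 0, 0, c] = c • (1 : Matrix (Fin 3) (Fin 3) ℂ) := by
      ext i j; fin_cases i <;> fin_cases j <;> simp
    rw [e] at h
    obtain ⟨d, hd⟩ := h.scalar
    exact hA d hd)
  obtain ⟨s, t, C, hs, hC, e⟩ := (h.trans h').conj
  refine ⟨s, t, C, hs, hC, ?_⟩
  rw [e]
  exact hB
end
end

section
/- Let A be a 3×3 complex matrix. There exist λ ∈ ℂ, a nonzero row vector p ∈ ℂ³ and a nonzero column vector ℓ ∈ ℂ³ satisfying pA = λp, Aℓ = λℓ and pℓ = 0 if and only if the characteristic polynomial of A has a repeated root (i.e. some eigenvalue of A has algebraic multiplicity at least 2). -/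
open Matrix Complex Polynomial

noncomputable section

theorem charpoly_three (A : Matrix (Fin 3) (Fin 3) ℂ) :
    A.charpoly = X ^ 3 - C (A 0 0 + A 1 1 + A 2 2) * X ^ 2
      + C (A 0 0 * A 1 1 - A 0 1 * A 1 0 + A 0 0 * A 2 2 - A 0 2 * A 2 0
        + A 1 1 * A 2 2 - A 1 2 * A 2 1) * X - C A.det := by
  simp only [Matrix.charpoly, Matrix.det_fin_three, charmatrix_apply, Matrix.diagonal_apply]
  simp
  ring

theorem sq_dvd_iff (f : ℂ[X]) (μ : ℂ) (hf : f ≠ 0) :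
    (X - C μ) ^ 2 ∣ f ↔ f.eval μ = 0 ∧ f.derivative.eval μ = 0 := by
  rw [← le_rootMultiplicity_iff hf]
  exact one_lt_rootMultiplicity_iff_isRoot hf

/-- Adjugate trace of a three by three matrix. -/
def tra (B : Matrix (Fin 3) (Fin 3) ℂ) : ℂ :=
  B 0 0 * B 1 1 - B 0 1 * B 1 0 + B 0 0 * B 2 2 - B 0 2 * B 2 0
        + B 1 1 * B 2 2 - B 1 2 * B 2 1

theorem dvd_iff (A : Matrix (Fin 3) (Fin 3) ℂ) (μ : ℂ) :
    (X - C μ) ^ 2 ∣ A.charpoly ↔ (A - μ • 1).det = 0 ∧ tra (A - μ • 1) = 0 := by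
  rw [sq_dvd_iff _ _ A.charpoly_monic.ne_zero, charpoly_three]
  have e1 : eval μ (X ^ 3 - C (A 0 0 + A 1 1 + A 2 2) * X ^ 2
      + C (A 0 0 * A 1 1 - A 0 1 * A 1 0 + A 0 0 * A 2 2 - A 0 2 * A 2 0
        + A 1 1 * A 2 2 - A 1 2 * A 2 1) * X - C A.det) = - (A - μ • 1).det := by
    simp [Matrix.det_fin_three, Matrix.one_apply]
    ring
  have e2 : eval μ (derivative (X ^ 3 - C (A 0 0 + A 1 1 + A 2 2) * X ^ 2
      + C (A 0 0 * A 1 1 - A 0 1 * A 1 0 + A 0 0 * A 2 2 - A 0 2 * A 2 0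
        + A 1 1 * A 2 2 - A 1 2 * A 2 1) * X - C A.det)) = tra (A - μ • 1) := by
    simp only [derivative_sub, derivative_add, derivative_C_mul, derivative_X_pow, derivative_X,
      derivative_C]
    simp [tra, Matrix.one_apply]
    ring
  rw [e1, e2, neg_eq_zero]

theorem row_prop (B : Matrix (Fin 3) (Fin 3) ℂ) (p : V3) (h : p ᵥ* B = 0) (i j k : Fin 3) :
    p j * B.adjugate i k = p k * B.adjugate i j := by
  have h0 := congrFun h 0
  have h1 := congrFun h 1
  have h2 := congrFun h 2
  simp [Matrix.vecMul, dotProduct, Fin.sum_univ_three] at h0 h1 h2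
  rw [Matrix.adjugate_fin_three]
  fin_cases i <;> fin_cases j <;> fin_cases k <;> simp <;> grind

theorem col_prop (B : Matrix (Fin 3) (Fin 3) ℂ) (l : V3) (h : B *ᵥ l = 0) (i j k : Fin 3) :
    l j * B.adjugate k i = l k * B.adjugate j i := by
  have := row_prop Bᵀ l (by rwa [Matrix.vecMul_transpose]) i j k
  rwa [← Matrix.adjugate_transpose] at this

theorem tra_eq (B : Matrix (Fin 3) (Fin 3) ℂ) :
    tra B = B.adjugate 0 0 + B.adjugate 1 1 + B.adjugate 2 2 := by
  rw [Matrix.adjugate_fin_three]; simp [tra]; ring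

theorem adj_minor (B : Matrix (Fin 3) (Fin 3) ℂ) (h : B.det = 0) (i j k : Fin 3) :
    B.adjugate i k * B.adjugate k j = B.adjugate k k * B.adjugate i j := by
  have := row_prop B (fun m => B.adjugate k m) (by
    have := Matrix.adjugate_mul B
    rw [h, zero_smul] at this
    ext m
    exact congrFun (congrFun this k) m) i j k
  linear_combination this

theorem minor_zero (B : Matrix (Fin 3) (Fin 3) ℂ) (h : B.adjugate = 0) (i j k m : Fin 3) :
    B i j * B m k = B i k * B m j := by
  rw [Matrix.adjugate_fin_three] at h
  have h' := fun i j => congrFun (congrFun h i) j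
  have a00 := h' 0 0
  have a01 := h' 0 1
  have a02 := h' 0 2
  have a10 := h' 1 0
  have a11 := h' 1 1
  have a12 := h' 1 2
  have a20 := h' 2 0
  have a21 := h' 2 1
  have a22 := h' 2 2
  clear h h'
  simp at a00 a01 a02 a10 a11 a12 a20 a21 a22
  fin_cases i <;> fin_cases j <;> fin_cases k <;> fin_cases m <;> simp <;> grind

theorem key (B : Matrix (Fin 3) (Fin 3) ℂ) :
    (∃ p l : V3, p ≠ 0 ∧ l ≠ 0 ∧ p ᵥ* B = 0 ∧ B *ᵥ l = 0 ∧ pairing p l = 0) ↔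
      B.det = 0 ∧ tra B = 0 := by
  constructor
  · rintro ⟨p, l, hp, hl, hpB, hBl, hpl⟩
    refine ⟨Matrix.exists_mulVec_eq_zero_iff.mp ⟨l, hl, hBl⟩, ?_⟩
    obtain ⟨j, hj⟩ := Function.ne_iff.mp hp
    obtain ⟨i, hi⟩ := Function.ne_iff.mp hl
    have e : ∀ k, l i * p j * B.adjugate k k = l k * p k * B.adjugate i j := fun k => by
      linear_combination p j * col_prop B l hBl k i k + l k * row_prop B p hpB i j k
    have : (l i * p j) * tra B = 0 := by
      rw [tra_eq]
      unfold pairing at hpl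
      linear_combination e 0 + e 1 + e 2 + B.adjugate i j * hpl
    exact (mul_eq_zero.mp this).resolve_left (mul_ne_zero hi hj)
  · rintro ⟨hd, ht⟩
    by_cases hB : B.adjugate = 0
    · by_cases h0 : B = 0
      · subst h0
        refine ⟨![1, 0, 0], ![0, 1, 0], ?_, ?_, by simp, by simp, by simp [pairing]⟩
        · intro h; simpa using congrFun h 0
        · intro h; simpa using congrFun h 1
      · obtain ⟨i, hi⟩ := Function.ne_iff.mp h0
        obtain ⟨j, hij⟩ := Function.ne_iff.mp hi
        obtain ⟨l, hl, hBl⟩ := Matrix.exists_mulVec_eq_zero_iff.mpr hd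
        obtain ⟨p, hp, hM⟩ := Matrix.exists_mulVec_eq_zero_iff.mpr
          (show (!![B 0 j, B 1 j, B 2 j; l 0, l 1, l 2; 0, 0, 0]).det = 0 by
            simp [Matrix.det_fin_three])
        have m0 := congrFun hM 0
        have m1 := congrFun hM 1
        simp [Matrix.mulVec, dotProduct, Fin.sum_univ_three] at m0 m1
        refine ⟨p, l, hp, hl, ?_, hBl, by unfold pairing; linear_combination m1⟩
        ext k
        have e := minor_zero B hB i j k
        have : B i j * (p ᵥ* B) k = 0 := by
          simp only [Matrix.vecMul, dotProduct, Fin.sum_univ_three]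
          linear_combination p 0 * e 0 + p 1 * e 1 + p 2 * e 2 + B i k * m0
        exact (mul_eq_zero.mp this).resolve_left hij
    · obtain ⟨i, hi⟩ := Function.ne_iff.mp hB
      obtain ⟨j, hij⟩ := Function.ne_iff.mp hi
      have r := Matrix.adjugate_mul B
      have c := Matrix.mul_adjugate B
      rw [hd, zero_smul] at r c
      refine ⟨fun m => B.adjugate i m, fun m => B.adjugate m j, fun h => hij (congrFun h j),
        fun h => hij (congrFun h i), ?_, ?_, ?_⟩
      · ext m; exact congrFun (congrFun r i) m
      · ext m; exact congrFun (congrFun c m) j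
      · rw [tra_eq] at ht
        unfold pairing
        linear_combination adj_minor B hd i j 0 + adj_minor B hd i j 1 + adj_minor B hd i j 2
          + B.adjugate i j * ht

theorem stmt_3 (A : Matrix (Fin 3) (Fin 3) ℂ) :
    (∃ (lam : ℂ) (p ℓ : V3), p ≠ 0 ∧ ℓ ≠ 0 ∧
        Matrix.vecMul p A = lam • p ∧ Matrix.mulVec A ℓ = lam • ℓ ∧ pairing p ℓ = 0) ↔
      ∃ μ : ℂ, (X - Polynomial.C μ) ^ 2 ∣ A.charpoly := by
  refine exists_congr fun μ => ?_
  rw [dvd_iff, ← key]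
  simp only [Matrix.vecMul_sub, Matrix.sub_mulVec, Matrix.vecMul_smul, Matrix.smul_mulVec,
    Matrix.vecMul_one, Matrix.one_mulVec, sub_eq_zero]
end
end

section
/- Let λ, λ' ∈ ℂ∖{0,1} and a,b,c,a',b',c' ∈ ℂ, and let A = [[0,a,b],[0,1,c],[0,0,λ]] and A' = [[0,a',b'],[0,1,c'],[0,0,λ']]. Then A and A' are unitarily equivalent (there exists a unitary 3×3 matrix X with XA = A'X) if and only if λ = λ' and there exist real numbers θ₁, θ₂ such that a' = e^{iθ₁}a, c' = e^{iθ₂}c and b' = e^{i(θ₁+θ₂)}b. -/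
open Matrix Complex

noncomputable section

theorem unimod_exp (z : ℂ) (h : star z * z = 1) : ∃ t : ℝ, z = Complex.exp (t * Complex.I) := by
  refine ⟨z.arg, ?_⟩
  have h1 : ‖z‖ = 1 := by
    have h2 : ‖z‖ * ‖z‖ = 1 := by
      have := congrArg norm h
      simpa using this
    nlinarith [norm_nonneg z]
  have := Complex.norm_mul_exp_arg_mul_I z
  rw [h1] at this
  simpa using this.symm

theorem stmt_5 (lam lam' a b c a' b' c' : ℂ)
    (hlam0 : lam ≠ 0) (hlam1 : lam ≠ 1) (hlam'0 : lam' ≠ 0) (hlam'1 : lam' ≠ 1)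
    (A A' : Matrix (Fin 3) (Fin 3) ℂ)
    (hA : A = !![0,a,b; 0,1,c; 0,0,lam]) (hA' : A' = !![0,a',b'; 0,1,c'; 0,0,lam']) :
    (∃ X : Matrix (Fin 3) (Fin 3) ℂ, X ∈ Matrix.unitaryGroup (Fin 3) ℂ ∧ X * A = A' * X) ↔
      (lam = lam' ∧ ∃ θ₁ θ₂ : ℝ,
        a' = Complex.exp (θ₁ * Complex.I) * a ∧
        c' = Complex.exp (θ₂ * Complex.I) * c ∧
        b' = Complex.exp ((θ₁ + θ₂ : ℝ) * Complex.I) * b) := by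
  subst hA hA'
  constructor
  · rintro ⟨X, hX, h⟩
    rw [Matrix.mem_unitaryGroup_iff'] at hX
    have e := fun i j => congrFun (congrFun h i) j
    have u := fun i j => congrFun (congrFun hX i) j
    simp only [Matrix.mul_apply, Fin.sum_univ_three, Matrix.star_apply] at e u
    have e00 := e 0 0
    have e01 := e 0 1
    have e02 := e 0 2
    have e10 := e 1 0
    have e12 := e 1 2
    have e20 := e 2 0
    have e21 := e 2 1
    have e22 := e 2 2
    have u00 := u 0 0
    have u01 := u 0 1
    have u02 := u 0 2
    have u11 := u 1 1
    have u12 := u 1 2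
    have u22 := u 2 2
    clear e u
    simp at e00 e01 e02 e10 e12 e20 e21 e22
    have h20 : X 2 0 = 0 := by tauto
    have h10 : X 1 0 = 0 := by simpa [h20] using e10.symm
    simp [h20, h10] at u00 u01 u02 e21
    have n0 : X 0 0 ≠ 0 := by
      intro h0; simp [h0] at u00
    have h01 : X 0 1 = 0 := by tauto
    have h02 : X 0 2 = 0 := by tauto
    have h21 : X 2 1 = 0 := by
      have : (1 - lam') * X 2 1 = 0 := by linear_combination e21
      rcases mul_eq_zero.1 this with h | h
      · exact absurd (sub_eq_zero.1 h).symm hlam'1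
      · exact h
    simp [h01, h21] at u11 u12
    have n1 : X 1 1 ≠ 0 := by
      intro h0; simp [h0] at u11
    have h12 : X 1 2 = 0 := by tauto
    simp [h02, h12] at u22
    have n2 : X 2 2 ≠ 0 := by
      intro h0; simp [h0] at u22
    simp [h01, h02, h10, h20, h12, h21] at e01 e02 e12 e22
    obtain ⟨p, hp⟩ := unimod_exp _ u00
    obtain ⟨q, hq⟩ := unimod_exp _ u11
    obtain ⟨r, hr⟩ := unimod_exp _ u22
    refine ⟨?_, p - q, q - r, ?_, ?_, ?_⟩
    · apply mul_left_cancel₀ n2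
      linear_combination e22
    · push_cast
      rw [sub_mul, Complex.exp_sub, ← hp, ← hq]
      field_simp
      linear_combination -e01
    · push_cast
      rw [sub_mul, Complex.exp_sub, ← hq, ← hr]
      field_simp
      linear_combination -e12
    · rw [sub_add_sub_cancel]
      push_cast
      rw [sub_mul, Complex.exp_sub, ← hp, ← hr]
      field_simp
      linear_combination -e02
  · rintro ⟨rfl, s, t, rfl, rfl, rfl⟩
    have key : ∀ x : ℝ, star (Complex.exp (x * I)) * Complex.exp (x * I) = 1 := by
      intro x
      rw [Complex.star_def, ← Complex.exp_conj, ← Complex.exp_add]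
      simp
    refine ⟨Matrix.diagonal ![Complex.exp ((s + t : ℝ) * I), Complex.exp (t * I), 1], ?_, ?_⟩
    · rw [Matrix.mem_unitaryGroup_iff', Matrix.star_eq_conjTranspose,
        Matrix.diagonal_conjTranspose, Matrix.diagonal_mul_diagonal, ← Matrix.diagonal_one]
      congr 1
      funext i
      fin_cases i
      · exact key _
      · exact key _
      · simp
    · ext i j
      rw [Matrix.diagonal_mul, Matrix.mul_diagonal]
      fin_cases i <;> fin_cases j <;> simp [add_mul, Complex.exp_add] <;> ring
end
end

section
/- Let q ∈ ℂ³ be a nonzero row vector and m ∈ ℂ³ a nonzero column vector with qm ≠ 0, and let z ∈ ℂ³ be a nonzero row vector. Then the twistor fiber over z meets L_{q,m} — i.e. there exists (p,ℓ) with p,ℓ ≠ 0, pℓ = 0, zℓ = 0, pz* = 0, qℓ = 0 and pm = 0 — if and only if zΦz* = 0, where Φ is the 3×3 matrix Φ = (qm)I − mq (mq being the rank-one matrix product of the column vector m with the row vector q). -/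
open Matrix Complex

noncomputable section

lemma pairing_swap (p l : V3) : pairing p l = pairing l p := by
  simp only [pairing]; ring

lemma exists_common (u v w : V3) (h : (Matrix.of ![u, v, w]).det = 0) :
    ∃ x : V3, x ≠ 0 ∧ pairing u x = 0 ∧ pairing v x = 0 ∧ pairing w x = 0 := by
  obtain ⟨x, hx, hM⟩ := Matrix.exists_mulVec_eq_zero_iff.mpr h
  refine ⟨x, hx, ?_, ?_, ?_⟩
  · simpa [Matrix.mulVec, dotProduct, Fin.sum_univ_three, pairing] using congrFun hM 0
  · simpa [Matrix.mulVec, dotProduct, Fin.sum_univ_three, pairing] using congrFun hM 1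
  · simpa [Matrix.mulVec, dotProduct, Fin.sum_univ_three, pairing] using congrFun hM 2

/-- If `p` kills `u` and `v`, then `p` is parallel to `u × v`. -/
lemma parallel_cross (p u v : V3) (hu : pairing p u = 0) (hv : pairing p v = 0) (i j : Fin 3) :
    p i * (crossProduct u v) j = p j * (crossProduct u v) i := by
  simp only [pairing] at hu hv
  fin_cases i <;> fin_cases j <;> simp [cross_apply] <;> grind

lemma form_eq (q m z w : V3) :
    pairing (Matrix.vecMul z (pairing q m • (1 : Matrix (Fin 3) (Fin 3) ℂ)
      - Matrix.vecMulVec m q)) w = pairing (crossProduct q z) (crossProduct m w) := by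
  simp [pairing, cross_apply, Matrix.vecMul, dotProduct, Fin.sum_univ_three, Matrix.vecMulVec_apply,
    Matrix.one_apply]
  ring

theorem stmt_8 (q m z : V3) (hq : q ≠ 0) (hm : m ≠ 0) (hqm : pairing q m ≠ 0) (hz : z ≠ 0)
    (Φ : Matrix (Fin 3) (Fin 3) ℂ)
    (hΦ : Φ = pairing q m • (1 : Matrix (Fin 3) (Fin 3) ℂ) - Matrix.vecMulVec m q) :
    (∃ p ℓ : V3, p ≠ 0 ∧ ℓ ≠ 0 ∧ pairing p ℓ = 0 ∧ pairing z ℓ = 0 ∧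
        pairing p (star z) = 0 ∧ pairing q ℓ = 0 ∧ pairing p m = 0) ↔
      pairing (Matrix.vecMul z Φ) (star z) = 0 := by
  subst hΦ
  rw [form_eq]
  generalize star z = w
  constructor
  · rintro ⟨p, l, hp, hl, hpl, hzl, hpw, hql, hpm⟩
    obtain ⟨i, hi⟩ := Function.ne_iff.mp hp
    obtain ⟨k, hk⟩ := Function.ne_iff.mp hl
    have ha := parallel_cross p m w hpm hpw i
    have hb := parallel_cross l q z (by rw [pairing_swap, hql]) (by rw [pairing_swap, hzl]) k
    generalize crossProduct m w = a at *
    generalize crossProduct q z = b at *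
    have : p i * l k * pairing b a = 0 := by
      have : p i * l k * pairing b a = a i * b k * pairing p l := by
        simp only [pairing]
        linear_combination (l k * b 0) * ha 0 + (l k * b 1) * ha 1 + (l k * b 2) * ha 2
          + (p 0 * a i) * hb 0 + (p 1 * a i) * hb 1 + (p 2 * a i) * hb 2
      rw [this, hpl, mul_zero]
    exact (mul_eq_zero.mp this).resolve_left (mul_ne_zero hi hk)
  · intro h
    by_cases hb : crossProduct q z = 0
    · obtain ⟨p, hp, hmp, hwp, -⟩ := exists_common m w 0 (by simp [Matrix.det_fin_three])
      obtain ⟨l, hl, hql, hpl, -⟩ := exists_common q p 0 (by simp [Matrix.det_fin_three])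
      refine ⟨p, l, hp, hl, hpl, ?_, by rw [pairing_swap, hwp], hql, by rw [pairing_swap, hmp]⟩
      obtain ⟨i, hi⟩ := Function.ne_iff.mp hq
      have h0 := congrFun hb 0
      have h1 := congrFun hb 1
      have h2 := congrFun hb 2
      simp [cross_apply] at h0 h1 h2
      have : q i * pairing z l = 0 := by
        simp only [pairing] at hql ⊢
        fin_cases i <;> simp <;> grind
      exact (mul_eq_zero.mp this).resolve_left hi
    · obtain ⟨p, hp, hmp, hwp, hbp⟩ := exists_common m w (crossProduct q z) (by
        rw [← h]
        simp [Matrix.det_fin_three, pairing, cross_apply]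
        ring)
      refine ⟨p, crossProduct q z, hp, hb, by rw [pairing_swap, hbp], ?_,
        by rw [pairing_swap, hwp], ?_, by rw [pairing_swap, hmp]⟩
      · simp [pairing, cross_apply]; ring
      · simp [pairing, cross_apply]; ring
end
end

section
/- Let λ ∈ ℂ∖ℝ and A = diag(0,1,λ). Then S_A contains no twistor fibers: for every nonzero row vector q ∈ ℂ³ there exists (p,ℓ) with p,ℓ ≠ 0, pℓ = 0, qℓ = 0, pq* = 0 and pAℓ ≠ 0. -/
open Matrix Complex

noncomputable section

theorem real_comb_ne (lam : ℂ) (hlam : lam.im ≠ 0) (a b : ℝ) (h : a ≠ 0 ∨ b ≠ 0) :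
    (a : ℂ) + lam * (b : ℂ) ≠ 0 := by
  intro h0
  have h1 := congrArg Complex.im h0
  have h2 := congrArg Complex.re h0
  simp at h1 h2
  have hb : b = 0 := by
    rcases h1 with h1 | h1
    · exact absurd h1 hlam
    · exact h1
  subst hb
  simp at h2
  subst h2
  simp at h

theorem exists_p (lam : ℂ) (hlam : lam.im ≠ 0) (a b c : ℂ) (h : a ≠ 0 ∨ b ≠ 0 ∨ c ≠ 0) :
    ∃ x y z : ℂ, x * star a + y * star b + z * star c = 0 ∧
      c * x * y - lam * b * x * z + (lam - 1) * a * y * z ≠ 0 := by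
  have hn : ∀ z : ℂ, z * star z = ((Complex.normSq z : ℝ) : ℂ) := fun z => Complex.mul_conj z
  by_cases ha : a = 0
  · subst ha
    refine ⟨1, star c, -star b, by simp; ring, ?_⟩
    have := real_comb_ne lam hlam (normSq c) (normSq b) (by simp; tauto)
    rw [← hn, ← hn] at this
    convert this using 1
    ring
  by_cases hb : b = 0
  · subst hb
    refine ⟨star c, 1, -star a, by simp; ring, ?_⟩
    have := real_comb_ne lam hlam (normSq c + normSq a) (-normSq a) (by right; simpa using ha)
    push_cast at this
    rw [← hn, ← hn] at this
    convert this using 1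
    ring
  by_cases hc : c = 0
  · subst hc
    refine ⟨star b, -star a, 1, by simp; ring, ?_⟩
    have := real_comb_ne lam hlam (normSq a) (-(normSq a + normSq b)) (by left; simpa using ha)
    push_cast at this
    rw [← hn, ← hn] at this
    convert this using 1
    ring
  · refine ⟨star b, -star a, 0, by ring, ?_⟩
    simp [ha, hb, hc]

theorem stmt_11 (lam : ℂ) (hlam : lam.im ≠ 0)
    (A : Matrix (Fin 3) (Fin 3) ℂ) (hA : A = Matrix.diagonal ![0, 1, lam]) :
    ∀ q : V3, q ≠ 0 →
      ∃ p ℓ : V3, p ≠ 0 ∧ ℓ ≠ 0 ∧ pairing p ℓ = 0 ∧ pairing q ℓ = 0 ∧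
        pairing p (star q) = 0 ∧ pairing (Matrix.vecMul p A) ℓ ≠ 0 := by
  intro q hq
  have h : q 0 ≠ 0 ∨ q 1 ≠ 0 ∨ q 2 ≠ 0 := by
    by_contra hcon
    push Not at hcon
    apply hq
    ext i
    fin_cases i
    · exact hcon.1
    · exact hcon.2.1
    · exact hcon.2.2
  obtain ⟨x, y, z, h1, h2⟩ := exists_p lam hlam _ _ _ h
  have key : pairing (Matrix.vecMul ![x, y, z] A)
      ![q 1 * z - q 2 * y, q 2 * x - q 0 * z, q 0 * y - q 1 * x] ≠ 0 := by
    convert h2 using 1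
    subst hA
    simp [pairing, Matrix.vecMul_diagonal]
    ring
  refine ⟨![x, y, z], ![q 1 * z - q 2 * y, q 2 * x - q 0 * z, q 0 * y - q 1 * x],
    ?_, ?_, ?_, ?_, ?_, key⟩
  · intro h0
    rw [h0] at key
    simp [pairing] at key
  · intro h0
    rw [h0] at key
    simp [pairing] at key
  · simp [pairing]; ring
  · simp [pairing]; ring
  · simpa [pairing] using h1
end
end

section
/- Let λ ∈ ℂ∖ℝ and A = diag(0,1,λ). For every nonzero row vector q = (q₀,q₁,q₂) ∈ ℂ³, the set of pairs of projective classes ([p],[ℓ]) ∈ ℙ(ℂ³)×ℙ(ℂ³) with p,ℓ ≠ 0, pℓ = 0, pAℓ = 0, qℓ = 0 and pq* = 0 has exactly two elements if and only if R(q) ≠ 0, and exactly one element if and only if R(q) = 0, where R(q) = (|q₀|²(λ−1) + |q₁|²λ + |q₂|²)² − 4|q₀|²|q₂|²(λ−1). Thus the branch locus of the 2-to-1 twistor projection restricted to S_A is the zero set of R. -/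
open Matrix Complex

noncomputable section

/-- The fiber over `[q]` of the twistor projection restricted to `S_A`, as a set of pairs of
projective classes `([p],[ℓ]) ∈ ℙ(ℂ³)×ℙ(ℂ³)` with `pℓ = 0`, `pAℓ = 0`, `qℓ = 0`, `pq* = 0`. -/
def fiberPairs (A : Matrix (Fin 3) (Fin 3) ℂ) (q : V3) :
    Set (Projectivization ℂ V3 × Projectivization ℂ V3) :=
  {x | ∃ (p ℓ : V3) (hp : p ≠ 0) (hl : ℓ ≠ 0),
    x = (Projectivization.mk ℂ p hp, Projectivization.mk ℂ ℓ hl) ∧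
    pairing p ℓ = 0 ∧ pairing (Matrix.vecMul p A) ℓ = 0 ∧
    pairing q ℓ = 0 ∧ pairing p (star q) = 0}

/-- The branch-locus polynomial
`R(q) = (|q₀|²(λ−1) + |q₁|²λ + |q₂|²)² − 4|q₀|²|q₂|²(λ−1)`. -/
def Rq (lam : ℂ) (q : V3) : ℂ :=
  ((Complex.normSq (q 0) : ℂ) * (lam - 1) + (Complex.normSq (q 1) : ℂ) * lam
      + (Complex.normSq (q 2) : ℂ)) ^ 2
    - 4 * (Complex.normSq (q 0) : ℂ) * (Complex.normSq (q 2) : ℂ) * (lam - 1)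

/-- The cross product, in coordinates. -/
def cr (p q : V3) : V3 :=
  ![p 1 * q 2 - p 2 * q 1, p 2 * q 0 - p 0 * q 2, p 0 * q 1 - p 1 * q 0]

lemma par3 (v w : V3) (hw : w ≠ 0) (h : cr v w = 0) : ∃ t : ℂ, v = t • w := by
  have h0 : v 1 * w 2 - v 2 * w 1 = 0 := by simpa [cr] using congrFun h 0
  have h1 : v 2 * w 0 - v 0 * w 2 = 0 := by simpa [cr] using congrFun h 1
  have h2 : v 0 * w 1 - v 1 * w 0 = 0 := by simpa [cr] using congrFun h 2
  obtain ⟨i, hi⟩ := Function.ne_iff.mp hw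
  simp only [Pi.zero_apply] at hi
  refine ⟨v i / w i, ?_⟩
  funext j
  simp only [Pi.smul_apply, smul_eq_mul]
  rw [div_mul_eq_mul_div, eq_div_iff hi]
  fin_cases i <;> fin_cases j <;> simp <;> grind

lemma par2 (a b x y : ℂ) (hab : a ≠ 0 ∨ b ≠ 0) (h : a * x + b * y = 0) :
    ∃ t : ℂ, x = t * b ∧ y = t * (-a) := by
  by_cases hb : b = 0
  · have ha : a ≠ 0 := by tauto
    refine ⟨-y / a, ?_, by field_simp⟩
    subst hb
    simpa [ha] using h
  · refine ⟨x / b, by field_simp, ?_⟩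
    field_simp
    linear_combination h

lemma factor2 (α β γ : ℂ) : ∃ a b c d : ℂ, α = a * c ∧ β = a * d + b * c ∧ γ = b * d := by
  by_cases h : α = 0
  · exact ⟨0, 1, β, γ, by simp [h], by ring, by ring⟩
  · obtain ⟨s, hs⟩ := IsAlgClosed.exists_pow_nat_eq (β ^ 2 - 4 * α * γ) (n := 2) (by norm_num)
    refine ⟨α, (β + s) / 2, 1, (β - s) / (2 * α), by ring, by field_simp; ring, ?_⟩
    field_simp
    linear_combination hs

lemma pair_self (q : V3) (hq : q ≠ 0) : pairing q (star q) ≠ 0 := by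
  intro h
  apply hq
  simp only [pairing, Pi.star_apply, RCLike.star_def, Complex.mul_conj] at h
  have h' : normSq (q 0) + normSq (q 1) + normSq (q 2) = 0 := by exact_mod_cast h
  have n0 := normSq_nonneg (q 0)
  have n1 := normSq_nonneg (q 1)
  have n2 := normSq_nonneg (q 2)
  funext j
  fin_cases j
  · exact normSq_eq_zero.mp (show normSq (q 0) = 0 by linarith)
  · exact normSq_eq_zero.mp (show normSq (q 1) = 0 by linarith)
  · exact normSq_eq_zero.mp (show normSq (q 2) = 0 by linarith)

lemma cr_ne (p q : V3) (hq : q ≠ 0) (hp : p ≠ 0) (h : pairing p (star q) = 0) :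
    cr p q ≠ 0 := by
  intro hc
  obtain ⟨t, rfl⟩ := par3 p q hq hc
  have : t * pairing q (star q) = 0 := by
    rw [← h]; simp only [pairing, Pi.smul_apply, smul_eq_mul]; ring
  rcases mul_eq_zero.mp this with h | h
  · exact hp (by simp [h])
  · exact pair_self q hq h

/-- The quadratic form cutting out the fiber. -/
def QF (lam : ℂ) (q p : V3) : ℂ :=
  p 1 * (p 2 * q 0 - p 0 * q 2) + lam * p 2 * (p 0 * q 1 - p 1 * q 0)

lemma pairA (lam : ℂ) (p l : V3) :
    pairing (Matrix.vecMul p (Matrix.diagonal ![0, 1, lam])) l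
      = p 1 * l 1 + lam * p 2 * l 2 := by
  simp only [pairing, Matrix.vecMul_diagonal]
  simp [mul_comm]

lemma mem_fiber (lam : ℂ) (q : V3) (hq : q ≠ 0)
    (x : Projectivization ℂ V3 × Projectivization ℂ V3) :
    x ∈ fiberPairs (Matrix.diagonal ![0, 1, lam]) q ↔
      ∃ (p : V3) (hp : p ≠ 0) (hc : cr p q ≠ 0), pairing p (star q) = 0 ∧ QF lam q p = 0 ∧
        x = (Projectivization.mk ℂ p hp, Projectivization.mk ℂ (cr p q) hc) := by
  constructor
  · rintro ⟨p, l, hp, hl, rfl, h1, h2, h3, h4⟩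
    have hc := cr_ne p q hq hp h4
    obtain ⟨t, rfl⟩ : ∃ t : ℂ, l = t • cr p q := by
      apply par3 l _ hc
      simp only [pairing] at h1 h3
      funext j
      fin_cases j <;> simp [cr]
      · linear_combination p 0 * h3 - q 0 * h1
      · linear_combination p 1 * h3 - q 1 * h1
      · linear_combination p 2 * h3 - q 2 * h1
    have ht : t ≠ 0 := by rintro rfl; simp at hl
    refine ⟨p, hp, hc, h4, ?_, ?_⟩
    · rw [pairA] at h2
      have : t * QF lam q p = 0 := by
        rw [← h2]; simp [QF, cr]; ring
      exact (mul_eq_zero.mp this).resolve_left ht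
    · congr 1
      rw [Projectivization.mk_eq_mk_iff']
      exact ⟨t, rfl⟩
  · rintro ⟨p, hp, hc, h4, hQ, rfl⟩
    refine ⟨p, cr p q, hp, hc, rfl, ?_, ?_, ?_, h4⟩
    · simp [pairing, cr]; ring
    · rw [pairA, ← hQ]; simp [QF, cr]
    · simp [pairing, cr]; ring

lemma core (lam : ℂ) (q : V3) (hq : q ≠ 0) (e f : V3) (α β γ k : ℂ) (hk : k ≠ 0)
    (hW : ∀ p, pairing p (star q) = 0 ↔ ∃ x y : ℂ, p = x • e + y • f)
    (hind : ∀ x y : ℂ, x • e + y • f = 0 → x = 0 ∧ y = 0)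
    (hQ : ∀ x y : ℂ, QF lam q (x • e + y • f) = α * x ^ 2 + β * (x * y) + γ * y ^ 2)
    (hD : β ^ 2 - 4 * α * γ = k ^ 2 * Rq lam q)
    (hne : ¬ (α = 0 ∧ β = 0 ∧ γ = 0)) :
    ((fiberPairs (Matrix.diagonal ![0, 1, lam]) q).encard = 2 ↔ Rq lam q ≠ 0) ∧
    ((fiberPairs (Matrix.diagonal ![0, 1, lam]) q).encard = 1 ↔ Rq lam q = 0) := by
  obtain ⟨a, b, c, d, rfl, rfl, rfl⟩ := factor2 α β γ
  have hab : a ≠ 0 ∨ b ≠ 0 := by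
    by_contra! h; apply hne; simp [h.1, h.2]
  have hcd : c ≠ 0 ∨ d ≠ 0 := by
    by_contra! h; apply hne; simp [h.1, h.2]
  have key : ∀ a b : ℂ, (a ≠ 0 ∨ b ≠ 0) → b • e + (-a) • f ≠ 0 := by
    intro a b h h0
    have := hind _ _ h0
    rw [neg_eq_zero] at this; tauto
  have hP1 := key a b hab
  have hP2 := key c d hcd
  have hW1 : pairing (b • e + (-a) • f) (star q) = 0 := (hW _).2 ⟨_, _, rfl⟩
  have hW2 : pairing (d • e + (-c) • f) (star q) = 0 := (hW _).2 ⟨_, _, rfl⟩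
  have hC1 := cr_ne _ q hq hP1 hW1
  have hC2 := cr_ne _ q hq hP2 hW2
  have crs : ∀ (t : ℂ) (p : V3), cr (t • p) q = t • cr p q := by
    intro t p; funext j; fin_cases j <;> simp [cr] <;> ring
  have mkeq : ∀ (t : ℂ) (p r : V3) (hp : p ≠ 0) (hr : r ≠ 0) (hcp : cr p q ≠ 0)
      (hcr : cr r q ≠ 0), p = t • r →
      (Projectivization.mk ℂ p hp, Projectivization.mk ℂ (cr p q) hcp)
       = (Projectivization.mk ℂ r hr, Projectivization.mk ℂ (cr r q) hcr) := by
    intro t p r hp hr hcp hcr h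
    subst h
    refine Prod.ext ?_ ?_
    · exact (Projectivization.mk_eq_mk_iff' _ _ _ _ _).2 ⟨t, rfl⟩
    · exact (Projectivization.mk_eq_mk_iff' _ _ _ _ _).2 ⟨t, (crs t r).symm⟩
  set X1 := (Projectivization.mk ℂ _ hP1, Projectivization.mk ℂ _ hC1) with hX1
  set X2 := (Projectivization.mk ℂ _ hP2, Projectivization.mk ℂ _ hC2) with hX2
  have hset : fiberPairs (Matrix.diagonal ![0, 1, lam]) q = {X1, X2} := by
    ext x
    rw [mem_fiber lam q hq, Set.mem_insert_iff, Set.mem_singleton_iff]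
    constructor
    · rintro ⟨p, hp, hc, hw, hq0, rfl⟩
      obtain ⟨x, y, rfl⟩ := (hW p).1 hw
      rw [hQ] at hq0
      have : (a * x + b * y) * (c * x + d * y) = 0 := by linear_combination hq0
      rcases mul_eq_zero.mp this with h | h
      · left
        obtain ⟨t, h1, h2⟩ := par2 a b x y hab h
        exact mkeq t _ _ _ _ _ _ (by rw [h1, h2, smul_add, smul_smul, smul_smul])
      · right
        obtain ⟨t, h1, h2⟩ := par2 c d x y hcd h
        exact mkeq t _ _ _ _ _ _ (by rw [h1, h2, smul_add, smul_smul, smul_smul])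
    · rintro (h | h)
      · exact ⟨_, hP1, hC1, hW1, by rw [hQ]; ring, h⟩
      · exact ⟨_, hP2, hC2, hW2, by rw [hQ]; ring, h⟩
  have hD' : (a * d - b * c) ^ 2 = k ^ 2 * Rq lam q := by rw [← hD]; ring
  have hX : X1 = X2 ↔ Rq lam q = 0 := by
    constructor
    · intro h
      have h1 := (Projectivization.mk_eq_mk_iff' _ _ _ _ _).1 (congrArg Prod.fst h)
      obtain ⟨t, ht⟩ := h1
      have h2 := hind (t * d - b) (t * (-c) + a) (by
        have h3 := sub_eq_zero.mpr ht
        rw [← h3]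
        module)
      have h4 : a * d - b * c = 0 := by linear_combination d * h2.2 + c * h2.1
      rw [h4] at hD'
      have : k ^ 2 * Rq lam q = 0 := by rw [← hD']; ring
      exact (mul_eq_zero.mp this).resolve_left (pow_ne_zero 2 hk)
    · intro h
      rw [h, mul_zero] at hD'
      have h4 : a * d - b * c = 0 := by simpa using hD'
      obtain ⟨t, h1, h2⟩ := par2 c d b (-a) hcd (by linear_combination -h4)
      exact mkeq t _ _ _ _ _ _ (by rw [h1, h2, smul_add, smul_smul, smul_smul])
  rw [hset]
  by_cases h : X1 = X2
  · have hR := hX.1 h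
    rw [h, Set.pair_eq_singleton, Set.encard_singleton]
    simp [hR]
  · have hR : Rq lam q ≠ 0 := fun h' => h (hX.2 h')
    rw [Set.encard_pair h]
    simp [hR]

/-- The form does not vanish identically on the line. -/
lemma QF_ne (lam : ℂ) (hlam : lam.im ≠ 0) (q : V3) (hq : q ≠ 0) :
    ¬ ∀ p, pairing p (star q) = 0 → QF lam q p = 0 := by
  intro h
  have l1 : (1 : ℂ) - lam ≠ 0 := by
    intro h; apply hlam
    have := congrArg Complex.im h
    simpa using this
  have n0 := normSq_nonneg (q 0)
  have n1 := normSq_nonneg (q 1)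
  have fin : normSq (q 0) = 0 → normSq (q 1) = 0 → normSq (q 2) = 0 → False := by
    intro a b c
    apply hq
    funext j
    fin_cases j
    · exact normSq_eq_zero.mp a
    · exact normSq_eq_zero.mp b
    · exact normSq_eq_zero.mp c
  have hA := h ![0, star (q 2), -star (q 1)] (by simp [pairing]; ring)
  have hA' : (1 - lam) * (q 0 * (star (q 1) * star (q 2))) = 0 := by
    simp only [QF] at hA
    simp at hA
    simp only [RCLike.star_def]
    linear_combination -hA
  have hz : q 0 = 0 ∨ q 1 = 0 ∨ q 2 = 0 := by
    simpa [l1] using hA'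
  have m0 := Complex.mul_conj (q 0)
  have m1 := Complex.mul_conj (q 1)
  have m2 := Complex.mul_conj (q 2)
  rcases hz with hz | hz | hz
  · have hB := h ![1, star (q 2), -star (q 1)] (by simp [pairing, hz]; ring)
    have hB' : (normSq (q 2) : ℂ) + lam * normSq (q 1) = 0 := by
      rw [← m1, ← m2]
      simp [QF, hz] at hB
      linear_combination -hB
    have i := congrArg Complex.im hB'
    have r := congrArg Complex.re hB'
    simp [hlam] at i
    simp [i] at r
    exact fin (by simp [hz]) (by simp [i]) (by simp [r])
  · have hB := h ![-star (q 2), 1, star (q 0)] (by simp [pairing, hz]; ring)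
    have hB' : (normSq (q 2) : ℂ) + (1 - lam) * normSq (q 0) = 0 := by
      rw [← m0, ← m2]
      simp [QF, hz] at hB
      linear_combination hB
    have i := congrArg Complex.im hB'
    have r := congrArg Complex.re hB'
    simp [hlam] at i
    simp [i] at r
    exact fin (by simp [i]) (by simp [hz]) (by simp [r])
  · have hB := h ![star (q 1), -star (q 0), 1] (by simp [pairing, hz]; ring)
    have hB' : lam * normSq (q 1) - (1 - lam) * normSq (q 0) + 0 = 0 := by
      rw [← m0, ← m1]
      simp [QF, hz] at hB
      linear_combination hB
    have i := congrArg Complex.im hB'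
    simp at i
    have i' : lam.im * (normSq (q 1) + normSq (q 0)) = 0 := by linear_combination i
    have i2 := (mul_eq_zero.mp i').resolve_left hlam
    exact fin (by linarith) (by linarith) (by simp [hz])

lemma core' (lam : ℂ) (hlam : lam.im ≠ 0) (q : V3) (hq : q ≠ 0) (e f : V3) (α β γ k : ℂ)
    (hk : k ≠ 0)
    (hW : ∀ p, pairing p (star q) = 0 ↔ ∃ x y : ℂ, p = x • e + y • f)
    (hind : ∀ x y : ℂ, x • e + y • f = 0 → x = 0 ∧ y = 0)
    (hQ : ∀ x y : ℂ, QF lam q (x • e + y • f) = α * x ^ 2 + β * (x * y) + γ * y ^ 2)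
    (hD : β ^ 2 - 4 * α * γ = k ^ 2 * Rq lam q) :
    ((fiberPairs (Matrix.diagonal ![0, 1, lam]) q).encard = 2 ↔ Rq lam q ≠ 0) ∧
    ((fiberPairs (Matrix.diagonal ![0, 1, lam]) q).encard = 1 ↔ Rq lam q = 0) := by
  refine core lam q hq e f α β γ k hk hW hind hQ hD ?_
  rintro ⟨h1, h2, h3⟩
  apply QF_ne lam hlam q hq
  intro p hp
  obtain ⟨x, y, rfl⟩ := (hW p).1 hp
  rw [hQ, h1, h2, h3]; ring

theorem stmt_12 (lam : ℂ) (hlam : lam.im ≠ 0)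
    (A : Matrix (Fin 3) (Fin 3) ℂ) (hA : A = Matrix.diagonal ![0, 1, lam]) :
    ∀ q : V3, q ≠ 0 →
      ((fiberPairs A q).encard = 2 ↔ Rq lam q ≠ 0) ∧
      ((fiberPairs A q).encard = 1 ↔ Rq lam q = 0) := by
  subst hA
  intro q hq
  obtain ⟨i, hi⟩ := Function.ne_iff.mp hq
  fin_cases i <;> simp at hi
  · have hs : (starRingEnd ℂ) (q 0) ≠ 0 := by simpa using hi
    refine core' lam hlam q hq ![star (q 1), -star (q 0), 0] ![star (q 2), 0, -star (q 0)]
      (star (q 0) * star (q 1) * q 2)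
      (star (q 0)^2 * q 0 * (1 - lam) + star (q 0) * star (q 2) * q 2 - lam * q 1 * star (q 0) * star (q 1))
      (-lam * q 1 * star (q 0) * star (q 2))
      (star (q 0)) (by simpa using hi) ?_ ?_ ?_ ?_
    · intro p
      constructor
      · intro h
        simp [pairing] at h
        refine ⟨-p 1 / star (q 0), -p 2 / star (q 0), ?_⟩
        funext j
        fin_cases j <;> simp <;> field_simp <;> linear_combination h
      · rintro ⟨x, y, rfl⟩
        simp [pairing]; ring
    · intro x y h
      have h1 := congrFun h 1
      have h2 := congrFun h 2
      simp [hi] at h1 h2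
      exact ⟨h1, h2⟩
    · intro x y
      simp [QF]; ring
    · simp only [Rq, ← Complex.mul_conj, RCLike.star_def]; ring
  · have hs : (starRingEnd ℂ) (q 1) ≠ 0 := by simpa using hi
    refine core' lam hlam q hq ![-star (q 1), star (q 0), 0] ![0, star (q 2), -star (q 1)]
      (q 2 * star (q 1) * star (q 0))
      (-(1 - lam) * q 0 * star (q 1) * star (q 0) + q 2 * star (q 1) * star (q 2) + lam * q 1 * star (q 1)^2)
      (-(1 - lam) * q 0 * star (q 1) * star (q 2))
      (star (q 1)) (by simpa using hi) ?_ ?_ ?_ ?_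
    · intro p
      constructor
      · intro h
        simp [pairing] at h
        refine ⟨-p 0 / star (q 1), -p 2 / star (q 1), ?_⟩
        funext j
        fin_cases j <;> simp <;> field_simp <;> linear_combination h
      · rintro ⟨x, y, rfl⟩
        simp [pairing]; ring
    · intro x y h
      have h1 := congrFun h 0
      have h2 := congrFun h 2
      simp [hi] at h1 h2
      exact ⟨h1, h2⟩
    · intro x y
      simp [QF]; ring
    · simp only [Rq, ← Complex.mul_conj, RCLike.star_def]; ring
  · have hs : (starRingEnd ℂ) (q 2) ≠ 0 := by simpa using hi
    refine core' lam hlam q hq ![-star (q 2), 0, star (q 0)] ![0, -star (q 2), star (q 1)]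
      (-lam * q 1 * star (q 2) * star (q 0))
      (-(1 - lam) * q 0 * star (q 2) * star (q 0) - q 2 * star (q 2)^2 - lam * q 1 * star (q 2) * star (q 1))
      (-(1 - lam) * q 0 * star (q 2) * star (q 1))
      (star (q 2)) (by simpa using hi) ?_ ?_ ?_ ?_
    · intro p
      constructor
      · intro h
        simp [pairing] at h
        refine ⟨-p 0 / star (q 2), -p 1 / star (q 2), ?_⟩
        funext j
        fin_cases j <;> simp <;> field_simp <;> linear_combination h
      · rintro ⟨x, y, rfl⟩
        simp [pairing]; ring
    · intro x y h
      have h1 := congrFun h 0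
      have h2 := congrFun h 1
      simp [hi] at h1 h2
      exact ⟨h1, h2⟩
    · intro x y
      simp [QF]; ring
    · simp only [Rq, ← Complex.mul_conj, RCLike.star_def]; ring
end
end
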